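/- Fix integers N ≥ 2 and m ≥ 1 and positive constants β and r, and fix x ∈ ℝ^N. Let S^{N-1}(x,r) = ∂B_N(x,r), and for a strictly positive real function g on S^{N-1}(x,r) let subgraph_rad(g) = {y ∈ ℝ^N : y = x + ρ·(ω−x)/r, 0 ≤ ρ ≤ g(ω), ω ∈ S^{N-1}(x,r)}. For ε > 0 let Y_{mβε}(S^{N-1}(x,r)) be the set of radial subgraphs of functions g of class C^m on S^{N-1}(x,r) with ‖g‖_{C^m} ≤ β and r ≤ g ≤ r + ε, regarded as a metric space with the Hausdorff distance. Then there exists ε₀ > 0, depending on N, m, β and r only, such that for every ε with 0 < ε < ε₀ there exists a subset Z_ε of Y_{mβε}(S^{N-1}(x,r)) that is ε-discrete with respect to the Hausdorff distance and has at least exp(2^{-N} ε₀^{(N-1)/m} ε^{-(N-1)/m}) elements. -/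

import Mathlib

lemma grid_points (n M : ℕ) (a r : ℝ) (ha : 0 < a) (hr : 0 < r)
    (haM : a * M ≤ r / ((n + 1 : ℕ) : ℝ)) (x : EuclideanSpace ℝ (Fin (n + 1))) :
    ∃ p : (Fin n → Fin M) → EuclideanSpace ℝ (Fin (n + 1)),
      (∀ k, p k ∈ Metric.sphere x r) ∧ ∀ k l, k ≠ l → a ≤ dist (p k) (p l) := by
  have hsum : ∀ k : Fin n → Fin M, ∑ j, (a * ((k j : ℕ) : ℝ)) ^ 2 ≤ r ^ 2 := by
    intro k
    have h1 : ∀ j ∈ (Finset.univ : Finset (Fin n)),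
        (a * ((k j : ℕ) : ℝ)) ^ 2 ≤ (r / ((n + 1 : ℕ) : ℝ)) ^ 2 := by
      intro j _
      have : ((k j : ℕ) : ℝ) ≤ M := by exact_mod_cast (k j).2.le
      apply pow_le_pow_left₀ (by positivity)
      exact le_trans (by gcongr) haM
    have h2 := Finset.sum_le_sum h1
    refine h2.trans ?_
    simp only [Finset.sum_const, Finset.card_univ, Fintype.card_fin, nsmul_eq_mul]
    rw [div_pow, mul_div_assoc', div_le_iff₀ (by positivity)]
    push_cast
    have : (0 : ℝ) ≤ n := by positivity
    nlinarith [sq_nonneg r, mul_nonneg this (sq_nonneg r), mul_nonneg this (mul_nonneg this (sq_nonneg r))]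
  let w : (Fin n → Fin M) → EuclideanSpace ℝ (Fin (n + 1)) := fun k =>
    WithLp.toLp 2 (Fin.cons (Real.sqrt (r ^ 2 - ∑ j, (a * ((k j : ℕ) : ℝ)) ^ 2))
      (fun j => a * ((k j : ℕ) : ℝ)) : Fin (n + 1) → ℝ)
  refine ⟨fun k => x + w k, ?_, ?_⟩
  · intro k
    simp only [Metric.mem_sphere, dist_self_add_left]
    rw [EuclideanSpace.norm_eq, Fin.sum_univ_succ]
    simp only [w, Fin.cons_zero, Fin.cons_succ, Real.norm_eq_abs, sq_abs]
    rw [Real.sq_sqrt (by linarith [hsum k]), sub_add_cancel, Real.sqrt_sq hr.le]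
  · intro k l hkl
    obtain ⟨j, hj⟩ := Function.ne_iff.mp hkl
    rw [dist_add_left, dist_eq_norm]
    refine le_trans ?_ (PiLp.norm_apply_le (w k - w l) j.succ)
    simp only [w, PiLp.sub_apply, Fin.cons_succ, Real.norm_eq_abs]
    rw [← mul_sub, abs_mul, abs_of_pos ha]
    have h3 : ((k j : ℕ) : ℤ) - (l j : ℕ) ≠ 0 := by
      intro h; apply hj; ext; omega
    have h4 : (1 : ℝ) ≤ |((k j : ℕ) : ℝ) - ((l j : ℕ) : ℝ)| := by
      have := Int.one_le_abs h3
      exact_mod_cast this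
    nlinarith

lemma exists_bump (N m : ℕ) (β : ℝ) :
    ∃ (φ : EuclideanSpace ℝ (Fin N) → ℝ) (C : ℝ), ContDiff ℝ m φ ∧ φ 0 = 1 ∧
      (∀ z, 0 ≤ φ z ∧ φ z ≤ 1) ∧ 0 < C ∧ 2 * β ≤ C ∧
      (∀ i ≤ m, ∀ z, ‖iteratedFDeriv ℝ i φ z‖ ≤ C) ∧
      (∀ i, ∀ z, 1 / 2 < ‖z‖ → iteratedFDeriv ℝ i φ z = 0) ∧
      (∀ z, 1 / 2 < ‖z‖ → φ z = 0) := by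
  let φ : ContDiffBump (0 : EuclideanSpace ℝ (Fin N)) := ⟨1 / 4, 1 / 2, by norm_num, by norm_num⟩
  have hb : ∀ i : ℕ, ∃ D : ℝ, ∀ z, ‖iteratedFDeriv ℝ i φ z‖ ≤ D := by
    intro i
    have hc : Continuous (iteratedFDeriv ℝ i φ) :=
      (φ.contDiff (n := (i : ℕ∞))).continuous_iteratedFDeriv'
    exact (hc.bounded_above_of_compact_support (φ.hasCompactSupport.iteratedFDeriv i))
  choose D hD using hb
  have hD0 : ∀ i, 0 ≤ D i := fun i => (norm_nonneg _).trans (hD i 0)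
  refine ⟨φ, ∑ i ∈ Finset.range (m + 1), D i + 2 * |β| + 1, φ.contDiff, ?_, ?_, ?_, ?_, ?_, ?_, ?_⟩
  · exact φ.one_of_mem_closedBall (by simp [φ])
  · exact fun z => ⟨φ.nonneg, φ.le_one⟩
  · have := Finset.sum_nonneg (s := Finset.range (m + 1)) (fun i _ => hD0 i)
    positivity
  · have := Finset.sum_nonneg (s := Finset.range (m + 1)) (fun i _ => hD0 i)
    linarith [le_abs_self β]
  · intro i hi z
    have := Finset.single_le_sum (s := Finset.range (m + 1)) (fun i _ => hD0 i)
      (Finset.mem_range.2 (Nat.lt_succ_of_le hi))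
    linarith [hD i z, abs_nonneg β]
  · intro i z hz
    by_contra h
    have := support_iteratedFDeriv_subset (𝕜 := ℝ) (f := φ) i h
    rw [φ.tsupport_eq] at this
    simp [φ] at this
    norm_num at hz
    linarith
  · intro z hz
    apply φ.zero_of_le_dist
    simp only [dist_zero_right, φ]
    linarith

lemma norm_sum_le_single {ι V : Type*} [NormedAddCommGroup V] (A : Finset ι)
    (f : ι → V) (B : ℝ) (hB : 0 ≤ B) (h : ∀ i, ‖f i‖ ≤ B)
    (u : ∀ i j, f i ≠ 0 → f j ≠ 0 → i = j) : ‖∑ i ∈ A, f i‖ ≤ B := by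
  by_cases H : ∃ i ∈ A, f i ≠ 0
  · obtain ⟨i, hi, hf⟩ := H
    rw [Finset.sum_eq_single_of_mem i hi]
    · exact h i
    · intro j _ hj
      by_contra h'
      exact hj (u j i h' hf)
  · push Not at H
    rw [Finset.sum_eq_zero H]
    simpa using hB

lemma scaled_deriv {E : Type*} [NormedAddCommGroup E] [NormedSpace ℝ E] (φ : E → ℝ) (i : ℕ)
    (hφ : ContDiff ℝ i φ) (ε c : ℝ) (p z : E) :
    iteratedFDeriv ℝ i (fun z => ε * φ (c • (z - p))) z
      = (ε * c ^ i) • iteratedFDeriv ℝ i φ (c • (z - p)) := by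
  have h1 : ContDiff ℝ i (fun z => φ (c • z)) := by fun_prop
  have h2 : ContDiff ℝ i (fun z => φ (c • (z - p))) := by fun_prop
  have := iteratedFDeriv_const_smul_apply' (𝕜 := ℝ) (a := ε) (h2.contDiffAt (x := z))
  simp only [smul_eq_mul] at this
  rw [this, iteratedFDeriv_comp_sub (𝕜 := ℝ) (f := fun z => φ (c • z)), iteratedFDeriv_comp_const_smul c hφ]
  simp [mul_smul]

def subgraphRad {E : Type*} [NormedAddCommGroup E] [NormedSpace ℝ E] (x : E) (r : ℝ)
    (g : E → ℝ) : Set E :=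
  {y : E | ∃ ω ∈ Metric.sphere x r, ∃ ρ : ℝ, 0 ≤ ρ ∧ ρ ≤ g ω ∧ y = x + (ρ / r) • (ω - x)}

lemma subgraphRad_sep {E : Type*} [NormedAddCommGroup E] [NormedSpace ℝ E] (x p : E)
    (r ε δ : ℝ) (hr : 0 < r) (hε : 0 < ε) (hδ : 2 * ε ≤ δ) (g h : E → ℝ)
    (hp : p ∈ Metric.sphere x r) (hgp : g p = r + ε)
    (hg : ∀ ω ∈ Metric.sphere x r, g ω ≤ r + ε)
    (hh : ∀ ω ∈ Metric.sphere x r, r ≤ h ω ∧ h ω ≤ r + ε)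
    (hhp : ∀ ω ∈ Metric.sphere x r, dist ω p < δ → h ω = r) :
    ε ≤ Metric.hausdorffDist (subgraphRad x r g) (subgraphRad x r h) := by
  have hnorm : ∀ ω ∈ Metric.sphere x r, ‖ω - x‖ = r := fun ω hω => by
    rwa [mem_sphere_iff_norm] at hω
  have hns : ∀ ω ∈ Metric.sphere x r, ∀ ρ : ℝ, ‖(ρ / r) • (ω - x)‖ = |ρ| := fun ω hω ρ => by
    rw [norm_smul, hnorm ω hω, Real.norm_eq_abs, abs_div, abs_of_pos hr]
    field_simp
  have hbdd : ∀ f : E → ℝ, (∀ ω ∈ Metric.sphere x r, f ω ≤ r + ε) →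
      Bornology.IsBounded (subgraphRad x r f) := by
    intro f hf
    refine (Metric.isBounded_closedBall (x := x) (r := r + ε)).subset ?_
    rintro y ⟨ω, hω, ρ, h0, h1, rfl⟩
    rw [mem_closedBall_iff_norm, add_sub_cancel_left, hns ω hω, abs_of_nonneg h0]
    exact h1.trans (hf ω hω)
  have hq : x + ((r + ε) / r) • (p - x) ∈ subgraphRad x r g :=
    ⟨p, hp, r + ε, by positivity, hgp.ge, rfl⟩
  have hne : (subgraphRad x r h).Nonempty :=
    ⟨_, p, hp, 0, le_rfl, hr.le.trans (hh p hp).1, rfl⟩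
  have hfin := Metric.hausdorffEDist_ne_top_of_nonempty_of_bounded ⟨_, hq⟩ hne (hbdd g hg)
    (hbdd h fun ω hω => (hh ω hω).2)
  refine le_trans ?_ (Metric.infDist_le_hausdorffDist_of_mem hq hfin)
  rw [Metric.le_infDist hne]
  rintro y ⟨ω, hω, ρ, h0, h1, rfl⟩
  rw [dist_add_left, dist_eq_norm]
  have hD1 : r + ε - ρ ≤ ‖((r + ε) / r) • (p - x) - (ρ / r) • (ω - x)‖ := by
    have := norm_sub_norm_le (((r + ε) / r) • (p - x)) ((ρ / r) • (ω - x))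
    rwa [hns p hp, hns ω hω, abs_of_nonneg h0, abs_of_pos (by positivity)] at this
  by_cases hc : dist ω p < δ
  · have := hhp ω hω hc
    linarith
  · push Not at hc
    have hρ : ρ ≤ r + ε := h1.trans (hh ω hω).2
    have key : ((r + ε) / r) • (p - ω) = (((r + ε) / r) • (p - x) - (ρ / r) • (ω - x))
        + ((ρ - (r + ε)) / r) • (ω - x) := by
      rw [sub_div, sub_smul, smul_sub, smul_sub, smul_sub, smul_sub]
      abel
    have h2 := norm_add_le (((r + ε) / r) • (p - x) - (ρ / r) • (ω - x))
      (((ρ - (r + ε)) / r) • (ω - x))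
    rw [← key, hns ω hω, abs_of_nonpos (by linarith), norm_smul, Real.norm_eq_abs,
      abs_of_pos (by positivity), ← dist_eq_norm p ω, dist_comm] at h2
    have h3 : 1 ≤ (r + ε) / r := by rw [le_div_iff₀ hr]; linarith
    have h4 : dist ω p ≤ (r + ε) / r * dist ω p := le_mul_of_one_le_left dist_nonneg h3
    linarith

theorem stmt7 (N m : ℕ) (hN : 2 ≤ N) (hm : 1 ≤ m) (β r : ℝ) (hβ : 0 < β) (hr : 0 < r)
    (x : EuclideanSpace ℝ (Fin N)) :
    ∃ ε₀ : ℝ, 0 < ε₀ ∧ ∀ ε : ℝ, 0 < ε → ε < ε₀ →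
      ∃ Z : Finset (Set (EuclideanSpace ℝ (Fin N))),
        (∀ S ∈ Z, ∃ g : EuclideanSpace ℝ (Fin N) → ℝ,
          ContDiff ℝ m g ∧
          (∀ i ≤ m, ∀ z, ‖iteratedFDeriv ℝ i (fun z => g z - r) z‖ ≤ β) ∧
          (∀ ω ∈ Metric.sphere x r, r ≤ g ω ∧ g ω ≤ r + ε) ∧
          S = {y : EuclideanSpace ℝ (Fin N) | ∃ ω ∈ Metric.sphere x r, ∃ ρ : ℝ,
                0 ≤ ρ ∧ ρ ≤ g ω ∧ y = x + (ρ / r) • (ω - x)}) ∧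
        (∀ S ∈ Z, ∀ T ∈ Z, S ≠ T → ε ≤ Metric.hausdorffDist S T) ∧
        Real.exp (2 ^ (-(N : ℝ)) * ε₀ ^ (((N : ℝ) - 1) / m) * ε ^ (-(((N : ℝ) - 1) / m)))
          ≤ (Z.card : ℝ) := by
  classical
  obtain ⟨n, rfl⟩ : ∃ n, N = n + 1 := ⟨N - 1, by omega⟩
  obtain ⟨φ, C, hφ, hφ0, hφ1, hC, hCβ, hφC, hφd, hφz⟩ := exists_bump (n + 1) m β
  have hm0 : (m : ℝ) ≠ 0 := by positivity
  set s : ℝ := min 1 (r / (4 * ((n + 1 : ℕ) : ℝ))) with hs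
  have hs0 : 0 < s := lt_min one_pos (by positivity)
  have hs1 : s ≤ 1 := min_le_left _ _
  have hsr : 4 * s ≤ r / ((n + 1 : ℕ) : ℝ) := by
    have : s ≤ r / (4 * ((n + 1 : ℕ) : ℝ)) := min_le_right _ _
    calc 4 * s ≤ 4 * (r / (4 * ((n + 1 : ℕ) : ℝ))) := by gcongr
      _ = _ := by field_simp
  refine ⟨β / C * s ^ m, by positivity, ?_⟩
  intro ε hε hε0
  set δ : ℝ := (ε * C / β) ^ ((m : ℝ)⁻¹) with hδ
  have hδ0 : 0 < δ := by positivity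
  have hδm : δ ^ m = ε * C / β := by
    rw [hδ]; exact Real.rpow_inv_natCast_pow (by positivity) (by omega)
  have hδs : δ < s := by
    refine lt_of_pow_lt_pow_left₀ m hs0.le ?_
    rw [hδm, div_lt_iff₀ hβ]
    calc ε * C < β / C * s ^ m * C := by gcongr
      _ = _ := by field_simp
  have hδ1 : δ ≤ 1 := hδs.le.trans hs1
  have hδε : 2 * ε ≤ δ := by
    have h1 : δ ^ m ≤ δ := by
      simpa using pow_le_pow_of_le_one hδ0.le hδ1 hm
    refine le_trans ?_ h1
    rw [hδm, le_div_iff₀ hβ]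
    nlinarith
  have hεδ : ∀ i ≤ m, ε * (δ⁻¹) ^ i * C ≤ β := by
    intro i hi
    have h1 : δ ^ m ≤ δ ^ i := pow_le_pow_of_le_one hδ0.le hδ1 hi
    rw [hδm, div_le_iff₀ hβ] at h1
    rw [inv_pow, mul_right_comm, ← div_eq_mul_inv, div_le_iff₀ (by positivity)]
    linarith
  set M : ℕ := ⌊2 * s / δ⌋₊ with hM
  have hM1 : (M : ℝ) ≤ 2 * s / δ := Nat.floor_le (by positivity)
  have hM2 : s / δ ≤ M := by
    have h1 : 2 * s / δ < M + 1 := Nat.lt_floor_add_one _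
    have h2 : 1 < s / δ := by rwa [one_lt_div hδ0]
    have h3 : 2 * s / δ = 2 * (s / δ) := by ring
    linarith
  obtain ⟨p, hps, hpd⟩ := grid_points n M (2 * δ) r (by positivity) hr (by
    refine le_trans ?_ hsr
    calc 2 * δ * M ≤ 2 * δ * (2 * s / δ) := by gcongr
      _ = 4 * s := by field_simp; ring) x
  have hnd : ∀ z i, ‖δ⁻¹ • (z - p i)‖ = dist z (p i) / δ := by
    intro z i
    rw [norm_smul, norm_inv, Real.norm_eq_abs, abs_of_pos hδ0, dist_eq_norm]; ring
  have hfar : ∀ z i j, i ≠ j → dist z (p i) < δ → 1 / 2 < ‖δ⁻¹ • (z - p j)‖ := by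
    intro z i j hij hd
    rw [hnd, lt_div_iff₀ hδ0]
    have := hpd i j hij
    have := dist_triangle_left (p i) (p j) z
    linarith
  have huniq : ∀ z i j, ¬ (1 / 2 < ‖δ⁻¹ • (z - p i)‖) → ¬ (1 / 2 < ‖δ⁻¹ • (z - p j)‖) → i = j := by
    intro z i j hi hj
    by_contra hij
    refine hj (hfar z i j hij ?_)
    rw [hnd, not_lt, div_le_iff₀ hδ0] at hi
    linarith
  let F : Finset (Fin n → Fin M) → EuclideanSpace ℝ (Fin (n + 1)) → ℝ :=
    fun A z => r + ∑ i ∈ A, ε * φ (δ⁻¹ • (z - p i))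
  have hF1 : ∀ A z, r ≤ F A z := by
    intro A z
    have : 0 ≤ ∑ i ∈ A, ε * φ (δ⁻¹ • (z - p i)) :=
      Finset.sum_nonneg fun i _ => mul_nonneg hε.le (hφ1 _).1
    simp only [F]; linarith
  have hF2 : ∀ A z, F A z ≤ r + ε := by
    intro A z
    have := norm_sum_le_single A (fun i => ε * φ (δ⁻¹ • (z - p i))) ε hε.le (by
      intro i
      rw [Real.norm_eq_abs, abs_of_nonneg (mul_nonneg hε.le (hφ1 _).1)]
      exact mul_le_of_le_one_right hε.le (hφ1 _).2) (by
      intro i j hi hj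
      refine huniq z i j (fun h => hi ?_) (fun h => hj ?_)
      · rw [hφz _ h, mul_zero]
      · rw [hφz _ h, mul_zero])
    have := (le_abs_self _).trans this
    simp only [F]; linarith
  have hFp : ∀ A, ∀ i ∈ A, F A (p i) = r + ε := by
    intro A i hi
    simp only [F]
    rw [Finset.sum_eq_single_of_mem i hi]
    · simp [hφ0]
    · intro j _ hj
      rw [hφz _ (hfar (p i) i j hj.symm (by simpa using hδ0)), mul_zero]
  have hFq : ∀ A, ∀ i ∉ A, ∀ z, dist z (p i) < δ → F A z = r := by
    intro A i hi z hz
    simp only [F]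
    rw [Finset.sum_eq_zero, add_zero]
    intro j hj
    have hij : i ≠ j := by rintro rfl; exact hi hj
    rw [hφz _ (hfar z i j hij hz), mul_zero]
  have hsep : ∀ A B, A ≠ B →
      ε ≤ Metric.hausdorffDist (subgraphRad x r (F A)) (subgraphRad x r (F B)) := by
    have aux : ∀ A B, ∀ i ∈ A, i ∉ B →
        ε ≤ Metric.hausdorffDist (subgraphRad x r (F A)) (subgraphRad x r (F B)) := by
      intro A B i hA hB
      exact subgraphRad_sep x (p i) r ε δ hr hε hδε (F A) (F B) (hps i) (hFp A i hA)
        (fun ω _ => hF2 A ω) (fun ω _ => ⟨hF1 B ω, hF2 B ω⟩) (fun ω _ => hFq B i hB ω)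
    intro A B hAB
    by_cases h : A ⊆ B
    · have h' : ¬ B ⊆ A := fun h' => hAB (h.antisymm h')
      obtain ⟨i, hi, hi'⟩ := Finset.not_subset.mp h'
      rw [Metric.hausdorffDist_comm]
      exact aux B A i hi hi'
    · obtain ⟨i, hi, hi'⟩ := Finset.not_subset.mp h
      exact aux A B i hi hi'
  have hinj : Function.Injective fun A => subgraphRad x r (F A) := by
    intro A B hAB
    by_contra h
    have h1 := hsep A B h
    simp only at hAB
    rw [hAB, Metric.hausdorffDist_self_zero] at h1
    linarith
  refine ⟨Finset.univ.image fun A => subgraphRad x r (F A), ?_, ?_, ?_⟩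
  · intro S hS
    obtain ⟨A, -, rfl⟩ := Finset.mem_image.mp hS
    refine ⟨F A, ?_, ?_, fun ω _ => ⟨hF1 A ω, hF2 A ω⟩, rfl⟩
    · simp only [F]; fun_prop
    · intro i hi z
      have hφi : ContDiff ℝ i φ := hφ.of_le (by exact_mod_cast hi)
      have h1 : (fun z => F A z - r) = fun z => ∑ i ∈ A, ε * φ (δ⁻¹ • (z - p i)) := by
        funext z; simp [F]
      rw [h1, iteratedFDeriv_fun_sum_apply (fun j _ => by
        apply ContDiff.contDiffAt; fun_prop)]
      simp only [scaled_deriv φ i hφi]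
      refine norm_sum_le_single A _ β hβ.le ?_ ?_
      · intro j
        rw [norm_smul, Real.norm_eq_abs, abs_of_pos (by positivity)]
        refine le_trans ?_ (hεδ i hi)
        gcongr
        exact hφC i hi _
      · intro j k hj hk
        refine huniq z j k (fun h => hj ?_) (fun h => hk ?_)
        · rw [hφd i _ h, smul_zero]
        · rw [hφd i _ h, smul_zero]
  · intro S hS T hT hST
    obtain ⟨A, -, rfl⟩ := Finset.mem_image.mp hS
    obtain ⟨B, -, rfl⟩ := Finset.mem_image.mp hT
    exact hsep A B (fun h => hST (by rw [h]))
  · rw [Finset.card_image_of_injective _ hinj, Finset.card_univ, Fintype.card_finset,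
      Fintype.card_fun, Fintype.card_fin, Fintype.card_fin]
    have e1 : ((((n + 1 : ℕ) : ℝ)) - 1) / m = (m : ℝ)⁻¹ * n := by push_cast; ring
    have e2 : (β / C * s ^ m) ^ ((m : ℝ)⁻¹ * n) * ε ^ (-((m : ℝ)⁻¹ * n)) = (s / δ) ^ n := by
      rw [Real.rpow_neg hε.le, ← div_eq_mul_inv, ← Real.div_rpow (by positivity) hε.le,
        Real.rpow_mul (by positivity), Real.rpow_natCast]
      congr 1
      have : β / C * s ^ m / ε = (s / δ) ^ m := by
        rw [div_pow, hδm]; field_simp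
      rw [this, Real.pow_rpow_inv_natCast (by positivity) (by omega)]
    rw [e1, mul_assoc, e2]
    have h2 : (2 : ℝ) ^ (-((n + 1 : ℕ) : ℝ)) ≤ Real.log 2 := by
      have : (2 : ℝ) ^ (-((n + 1 : ℕ) : ℝ)) ≤ (2 : ℝ) ^ (-1 : ℝ) := by
        apply Real.rpow_le_rpow_of_exponent_le (by norm_num)
        push_cast
        have : (0 : ℝ) ≤ n := by positivity
        linarith
      rw [Real.rpow_neg_one] at this
      have := Real.log_two_gt_d9
      norm_num at *
      linarith
    calc Real.exp (2 ^ (-((n + 1 : ℕ) : ℝ)) * (s / δ) ^ n)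
        ≤ Real.exp (Real.log 2 * (M : ℝ) ^ n) := by
          apply Real.exp_le_exp.mpr
          gcongr
      _ = _ := by
          rw [Real.exp_mul, Real.exp_log (by norm_num)]
          push_cast
          rw [← Nat.cast_pow, Real.rpow_natCast]
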